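/- (Reflection dynamics with ε = -1 compute parity.) Let α ∈ ℝ and let x₁, …, x_T ∈ {0,1}. Define h₀ = 0 and h_t = x_t·(α - h_{t-1}) + (1 - x_t)·h_{t-1} for t = 1, …, T (the scalar CMRU update with ε = -1, gate z_t = x_t, and candidate α). Then for every T: h_T = α if Σ_{t=1}^{T} x_t is odd, and h_T = 0 if Σ_{t=1}^{T} x_t is even. Equivalently, h_T = α·((Σ_{t=1}^{T} x_t) mod 2). -/

import Mathlib

/-- reflection dynamics with `ε = -1` compute parity: with `h₀ = 0` and
`h_t = x_t·(α - h_{t-1}) + (1 - x_t)·h_{t-1}` for binary `x_t`, we get `h_T = α` when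
`Σ x_t` is odd, `h_T = 0` when it is even; equivalently `h_T = α·((Σ x_t) mod 2)`. -/
theorem stmt14 (α : ℝ) (T : ℕ) (x : ℕ → ℕ) (hx : ∀ t, x t = 0 ∨ x t = 1)
    (h : ℕ → ℝ) (h0 : h 0 = 0)
    (hrec : ∀ t < T,
      h (t + 1) = (x (t + 1) : ℝ) * (α - h t) + (1 - (x (t + 1) : ℝ)) * h t) :
    (Odd (∑ t ∈ Finset.Icc 1 T, x t) → h T = α) ∧
    (Even (∑ t ∈ Finset.Icc 1 T, x t) → h T = 0) ∧
    h T = α * (((∑ t ∈ Finset.Icc 1 T, x t) % 2 : ℕ) : ℝ) := by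
  have key : h T = α * (((∑ t ∈ Finset.Icc 1 T, x t) % 2 : ℕ) : ℝ) := by
    induction T with
    | zero => simp [h0]
    | succ n ih =>
      have ihn := ih fun t ht => hrec t (ht.trans n.lt_succ_self)
      rw [hrec n n.lt_succ_self, ihn, Finset.sum_Icc_succ_top (Nat.le_add_left 1 n)]
      rcases hx (n + 1) with hz | hz
      · simp [hz]
      · rcases Nat.mod_two_eq_zero_or_one (∑ t ∈ Finset.Icc 1 n, x t) with hs | hs <;>
          simp [hz, hs, Nat.add_mod]
  refine ⟨fun ho => ?_, fun he => ?_, key⟩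
  · rw [key, Nat.odd_iff.mp ho, Nat.cast_one, mul_one]
  · rw [key, Nat.even_iff.mp he, Nat.cast_zero, mul_zero]
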